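/- There exists a function c assigning to every pair of ordinals α < β < ω₁ an ordinal c(α,β) < ω₁, such that for every uncountable set A ⊆ ω₁ and every γ < ω₁ there exist α, β ∈ A with α < β and c(α,β) = γ. -/

import Mathlib

noncomputable section

/-- The first uncountable ordinal `ω₁`. -/
def w1 : Ordinal := (Cardinal.aleph 1).ord

namespace StrongColoring

open Set Cardinal

section

variable {Ω : Type*} [LinearOrder Ω] [WellFoundedLT Ω]

/-- Countable sets are strictly bounded. -/
theorem bdd (hI : ∀ a : Ω, (Iio a).Countable) (hc : #Ω = ℵ₁) {S : Set Ω} (hS : S.Countable) :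
    ∃ b, ∀ x ∈ S, x < b := by
  by_contra! h
  have h1 : (⋃ x ∈ S, Iic x).Countable := by
    refine hS.biUnion fun x _ => ?_
    rw [← Iio_insert]
    exact (hI x).insert x
  have h2 : (⋃ x ∈ S, Iic x) = Set.univ := by
    ext b
    obtain ⟨x, hx, hb⟩ := h b
    simp only [mem_iUnion, Set.mem_univ, iff_true]
    exact ⟨x, hx, hb⟩
  rw [h2, countable_univ_iff, ← Cardinal.mk_le_aleph0_iff, hc] at h1
  exact absurd h1 (not_le.2 Cardinal.aleph0_lt_aleph_one)

/-- Closure points of `g`. -/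
def Cl (g : Ω → Ω) : Set Ω := {δ | (∃ ξ, ξ < δ) ∧ ∀ ξ < δ, g ξ < δ}

theorem Cl_anti {g h : Ω → Ω} (H : ∀ x, g x ≤ h x) : Cl h ⊆ Cl g :=
  fun _ hd => ⟨hd.1, fun ξ hξ => (H ξ).trans_lt (hd.2 ξ hξ)⟩

theorem Cl_nonempty (hI : ∀ a : Ω, (Iio a).Countable) (hc : #Ω = ℵ₁) (g : Ω → Ω) :
    (Cl g).Nonempty := by
  have hne : Nonempty Ω := by
    rw [← Cardinal.mk_ne_zero_iff, hc]
    exact (Cardinal.aleph_pos 1).ne'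
  have hstep : ∀ x : Ω, ∃ y, x < y ∧ ∀ ξ < x, g ξ < y := by
    intro x
    obtain ⟨b, hb⟩ := bdd hI hc (((hI x).image g).insert x)
    exact ⟨b, hb x (mem_insert _ _), fun ξ hξ => hb _ (mem_insert_of_mem _ ⟨ξ, hξ, rfl⟩)⟩
  choose s hs1 hs2 using hstep
  let x : ℕ → Ω := fun n => s^[n] hne.some
  have hx : ∀ n, x (n + 1) = s (x n) := fun n => Function.iterate_succ_apply' s n _
  have hU : {b | ∀ n, x n ≤ b}.Nonempty := by
    obtain ⟨b, hb⟩ := bdd hI hc (countable_range x)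
    exact ⟨b, fun n => (hb _ ⟨n, rfl⟩).le⟩
  have wf : WellFounded ((· < ·) : Ω → Ω → Prop) := wellFounded_lt
  refine ⟨wf.min _ hU, ⟨x 0, ?_⟩, ?_⟩
  · refine lt_of_lt_of_le ?_ (wf.min_mem _ hU 1)
    rw [hx 0]; exact hs1 _
  · intro ξ hξ
    have : ¬ ∀ n, x n ≤ ξ := fun h => wf.not_lt_min {b | ∀ n, x n ≤ b} (x := ξ) h hξ
    push Not at this
    obtain ⟨n, hn⟩ := this
    refine lt_of_lt_of_le ?_ (wf.min_mem _ hU (n + 1))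
    rw [hx]; exact hs2 _ _ hn

theorem exists_stat (hI : ∀ a : Ω, (Iio a).Countable) (hc : #Ω = ℵ₁) :
    ∃ f : Ω → Ω, ∀ γ (g : Ω → Ω), ∃ δ ∈ Cl g, f δ = γ := by
  have he : ∀ β : Ω, ∃ e : Ω → ℕ, InjOn e (Iio β) := fun β => countable_iff_exists_injOn.1 (hI β)
  choose e he using he
  have hn : ∀ α : Ω, ∃ n, ∀ g : Ω → Ω, ∃ δ ∈ Cl g, α < δ ∧ e δ α = n := by
    intro α
    by_contra! h
    choose g hg using h
    have : ∀ ξ, ∃ b, α < b ∧ ∀ n, g n ξ < b := by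
      intro ξ
      obtain ⟨b, hb⟩ := bdd hI hc ((countable_range fun n => g n ξ).insert α)
      exact ⟨b, hb _ (mem_insert _ _), fun n => hb _ (mem_insert_of_mem _ ⟨n, rfl⟩)⟩
    choose G hG1 hG2 using this
    obtain ⟨δ, hδ⟩ := Cl_nonempty hI hc G
    obtain ⟨ξ, hξ⟩ := hδ.1
    exact hg (e δ α) δ (Cl_anti (fun x => (hG2 x _).le) hδ) ((hG1 ξ).trans (hδ.2 ξ hξ)) rfl
  choose n hn using hn
  have hk : ∃ k, ¬ (n ⁻¹' {k}).Countable := by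
    by_contra! h
    have h1 : (⋃ k, n ⁻¹' {k}).Countable := countable_iUnion h
    have h2 : (⋃ k, n ⁻¹' {k}) = Set.univ := by ext; simp
    rw [h2, countable_univ_iff, ← Cardinal.mk_le_aleph0_iff, hc] at h1
    exact absurd h1 (not_le.2 Cardinal.aleph0_lt_aleph_one)
  obtain ⟨k, hk⟩ := hk
  have hB : #(n ⁻¹' {k}) = #Ω := by
    refine le_antisymm (Cardinal.mk_set_le _) ?_
    rw [hc]
    rw [← Cardinal.le_aleph0_iff_set_countable, not_le] at hk
    rw [← Cardinal.succ_aleph0]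
    exact Order.succ_le_of_lt hk
  obtain ⟨π⟩ := Cardinal.eq.1 hB
  classical
  refine ⟨fun δ => if h : ∃ a : n ⁻¹' {k}, (a : Ω) < δ ∧ e δ a = k then π h.choose else δ, ?_⟩
  intro γ g
  obtain ⟨δ, hδ, h1, h2⟩ := hn (π.symm γ) g
  refine ⟨δ, hδ, ?_⟩
  have hk' : n (π.symm γ) = k := (π.symm γ).2
  rw [hk'] at h2
  have h : ∃ a : n ⁻¹' {k}, (a : Ω) < δ ∧ e δ a = k := ⟨π.symm γ, h1, h2⟩
  simp only [dif_pos h]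
  have h3 := h.choose_spec
  have : h.choose = π.symm γ := Subtype.ext (he δ h3.1 h1 (h3.2.trans h2.symm))
  rw [this]; simp

theorem exists_close (hI : ∀ a : Ω, (Iio a).Countable) (hc : #Ω = ℵ₁) {ι : Type*} [Countable ι]
    (S : ι → Set Ω) : ∃ g : Ω → Ω, ∀ δ ∈ Cl g, ∀ i, (∀ x ∈ S i, x < δ) ∨
      ∀ ξ < δ, ∃ α ∈ S i, ξ < α ∧ α < δ := by
  have : ∀ ξ i, ∃ b, (∀ x ∈ S i, x < b) ∨ (b ∈ S i ∧ ξ < b) := by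
    intro ξ i
    by_cases h : (S i).Countable
    · obtain ⟨b, hb⟩ := bdd hI hc h
      exact ⟨b, Or.inl hb⟩
    · by_contra! h'
      apply h
      refine Countable.mono (s₂ := insert ξ (Iio ξ)) (fun x hx => ?_) ((hI ξ).insert ξ)
      have := (h' x).2 hx
      rw [Iio_insert]; exact this
  choose h hh using this
  have : ∀ ξ, ∃ b, ∀ i, h ξ i < b := by
    intro ξ
    obtain ⟨b, hb⟩ := bdd hI hc (countable_range (h ξ))
    exact ⟨b, fun i => hb _ ⟨i, rfl⟩⟩
  choose g hg using this
  refine ⟨g, fun δ hδ i => ?_⟩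
  by_cases hb : ∃ b < δ, ∀ x ∈ S i, x < b
  · obtain ⟨b, hb, h⟩ := hb
    exact Or.inl fun x hx => (h x hx).trans hb
  · refine Or.inr fun ξ hξ => ?_
    have h1 : h ξ i < δ := (hg ξ i).trans (hδ.2 ξ hξ)
    rcases hh ξ i with h2 | h2
    · exact absurd ⟨_, h1, h2⟩ hb
    · exact ⟨_, h2.1, h2.2, h1⟩

theorem fin_bdd {δ : Ω} (hδ : ∃ ξ, ξ < δ) (c : ℕ → Ω) (n : ℕ) (h : ∀ i < n, c i < δ) :
    ∃ ξ < δ, ∀ i < n, c i ≤ ξ := by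
  induction n with
  | zero => obtain ⟨ξ, h⟩ := hδ; exact ⟨ξ, h, by simp⟩
  | succ n ih =>
    obtain ⟨ξ, h1, h2⟩ := ih fun i hi => h i (by omega)
    refine ⟨max ξ (c n), max_lt h1 (h n (by omega)), fun i hi => ?_⟩
    rcases Nat.lt_succ_iff_lt_or_eq.1 hi with hi | rfl
    · exact (h2 i hi).trans (le_max_left _ _)
    · exact le_max_right _ _

/-- Walks: the operation depending on a threshold `m`. -/
theorem exists_walk (hI : ∀ a : Ω, (Iio a).Countable) :
    ∃ F : Ω → Ω → ℕ → Ω,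
      (∀ δ : Ω, (∃ ξ, ξ < δ) → ∀ m, ∃ ξ < δ, ∀ α, ξ < α → α < δ → ∀ m' ≤ m, F α δ m' = δ) ∧
      (∀ δ : Ω, (∃ ξ, ξ < δ) → ∀ β, δ ≤ β → ∃ k, ∃ ξ < δ, ∀ α, ξ < α → α < δ →
        ∀ m, k ≤ m → F α β m = F α δ m) := by
  have hcex : ∀ β : Ω, ∃ c : ℕ → Ω, (∃ ξ, ξ < β) → Iio β = range c := by
    intro β
    by_cases h : ∃ ξ, ξ < β
    · obtain ⟨c, hc⟩ := (hI β).exists_eq_range h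
      exact ⟨c, fun _ => hc⟩
    · exact ⟨fun _ => β, fun h' => absurd h' h⟩
  choose c hc using hcex
  let N : Ω → Ω → ℕ := fun β α => sInf {n | α ≤ c β n}
  have hlt : ∀ β, (∃ ξ, ξ < β) → ∀ n, c β n < β := by
    intro β h n
    have : c β n ∈ Iio β := by rw [hc β h]; exact ⟨n, rfl⟩
    exact this
  have hN : ∀ β α, α < β → α ≤ c β (N β α) := by
    intro β α h
    have : α ∈ range (c β) := by rw [← hc β ⟨α, h⟩]; exact h
    obtain ⟨n, hn⟩ := this
    exact Nat.sInf_mem (s := {n | α ≤ c β n}) ⟨n, hn.ge⟩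
  have hN' : ∀ β α i, i < N β α → c β i < α := by
    intro β α i h
    exact not_le.1 fun h' => Nat.notMem_of_lt_sInf h h'
  classical
  have wf : WellFounded ((· < ·) : Ω → Ω → Prop) := wellFounded_lt
  let F : Ω → Ω → ℕ → Ω := fun α β m => wf.fix (C := fun _ => Ω) (fun β ih =>
    if m ≤ N β α then β else if h : c β (N β α) < β then ih _ h else β) β
  have hF : ∀ α β m, F α β m =
      if m ≤ N β α then β else if c β (N β α) < β then F α (c β (N β α)) m else β := by
    intro α β m
    have := wf.fix_eq (C := fun _ => Ω) (fun β ih =>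
      if m ≤ N β α then β else if h : c β (N β α) < β then ih _ h else β) β
    simp only [dite_eq_ite] at this
    exact this
  refine ⟨F, ?_, ?_⟩
  · intro δ hδ m
    obtain ⟨ξ, h1, h2⟩ := fin_bdd hδ (c δ) m fun i _ => hlt δ hδ i
    refine ⟨ξ, h1, fun α h3 h4 m' hm => ?_⟩
    have : m ≤ N δ α := by
      by_contra! h
      exact absurd (hN δ α h4) (not_le.2 ((h2 _ h).trans_lt h3))
    rw [hF, if_pos (hm.trans this)]
  · intro δ hδ β
    induction β using wf.induction with
    | _ β ih =>
    intro hβ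
    rcases hβ.eq_or_lt with rfl | hβ
    · obtain ⟨ξ, hξ⟩ := hδ
      exact ⟨0, ξ, hξ, fun _ _ _ _ _ => rfl⟩
    · obtain ⟨k, ξ, h1, h2⟩ := ih _ (hlt β ⟨δ, hβ⟩ (N β δ)) (hN _ _ hβ)
      obtain ⟨ξ', h1', h2'⟩ := fin_bdd hδ (c β) (N β δ) (hN' β δ)
      refine ⟨max k (N β δ + 1), max ξ ξ', max_lt h1 h1', fun α h3 h4 m hm => ?_⟩
      have hα : N β α = N β δ := by
        apply le_antisymm
        · exact Nat.sInf_le (h4.le.trans (hN _ _ hβ))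
        · by_contra! h
          exact absurd (hN β α (h4.trans hβ))
            (not_le.2 ((h2' _ h).trans_lt ((le_max_right _ _).trans_lt h3)))
      have hm1 := (le_max_left _ _).trans hm
      have hm2 := (le_max_right _ _).trans hm
      rw [hF, if_neg (by omega), hα, if_pos (hlt β ⟨δ, hβ⟩ _)]
      exact h2 α ((le_max_left _ _).trans_lt h3) h4 m hm1

theorem exists_real (hc : #Ω = ℵ₁) : ∃ r : Ω → ℕ → Bool, Function.Injective r := by
  have : Cardinal.lift.{0} #Ω ≤ Cardinal.lift #(ℕ → Bool) := by
    rw [hc]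
    simpa using Cardinal.aleph_one_le_continuum
  obtain ⟨f⟩ := Cardinal.lift_mk_le'.1 this
  exact ⟨f, f.injective⟩

theorem main (hI : ∀ a : Ω, (Iio a).Countable) (hc : #Ω = ℵ₁) :
    ∃ C : Ω → Ω → Ω, ∀ A : Set Ω, ¬ A.Countable → ∀ γ, ∃ α ∈ A, ∃ β ∈ A, α < β ∧ C α β = γ := by
  obtain ⟨f, hf⟩ := exists_stat hI hc
  obtain ⟨r, hr⟩ := exists_real hc
  obtain ⟨F, hF1, hF2⟩ := exists_walk hI
  refine ⟨fun α β => f (F α β (PiNat.firstDiff (r α) (r β))), fun A hA γ => ?_⟩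
  let S : (Σ n : ℕ, (Fin n → Bool)) → Set Ω := fun s => {α | α ∈ A ∧ ∀ i : Fin s.1, r α i = s.2 i}
  obtain ⟨g, hg⟩ := exists_close hI hc S
  obtain ⟨δ, hδ, hfδ⟩ := hf γ g
  have key : ∀ x ∈ A, δ ≤ x → ∀ n : ℕ, ∀ ξ < δ, ∃ α ∈ A, (∀ i < n, r α i = r x i) ∧
      ξ < α ∧ α < δ := by
    intro x hx hxδ n ξ hξ
    rcases hg δ hδ ⟨n, fun i => r x i⟩ with h | h
    · exact absurd (h x ⟨hx, fun _ => rfl⟩) (not_lt.2 hxδ)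
    · obtain ⟨α, h1, h2, h3⟩ := h ξ hξ
      exact ⟨α, h1.1, fun i hi => h1.2 ⟨i, hi⟩, h2, h3⟩
  have hδ1 := hδ.1
  -- uncountably many points of `A` above `δ`; we need two agreeing up to `k`
  have hunc : ¬ (A \ Iio δ).Countable := fun h => hA (by
    refine (h.union (hI δ)).mono fun x hx => ?_
    by_cases h : x < δ
    · exact Or.inr h
    · exact Or.inl ⟨hx, h⟩)
  -- some β above δ whose every neighbourhood contains another point of `A` above `δ`
  have hβ : ∃ β ∈ A, δ ≤ β ∧ ∀ k : ℕ, ∃ y ∈ A, δ ≤ y ∧ y ≠ β ∧ ∀ i < k, r y i = r β i := by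
    by_contra! h
    apply hunc
    have h' : ∀ β ∈ A \ Iio δ, ∃ k : ℕ, ∀ y ∈ A, δ ≤ y → y ≠ β → ∃ i < k, r y i ≠ r β i :=
      fun β hβ => h β hβ.1 (not_lt.1 hβ.2)
    choose! k hk using h'
    let q : Ω → (Σ n : ℕ, (Fin n → Bool)) := fun β => ⟨k β, fun i => r β i⟩
    refine MapsTo.countable_of_injOn (f := q) (t := Set.univ) (fun _ _ => Set.mem_univ _) ?_
      (countable_univ)
    intro a ha b hb hab
    by_contra hne
    obtain ⟨i, hi, hi'⟩ := hk b hb a ha.1 (not_lt.1 ha.2) hne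
    have aux : ∀ s t : (Σ n : ℕ, (Fin n → Bool)), s = t → ∀ i (h1 : i < s.1) (h2 : i < t.1),
        s.2 ⟨i, h1⟩ = t.2 ⟨i, h2⟩ := by
      rintro s t rfl i h1 h2
      rfl
    have hkk : k a = k b := congrArg Sigma.fst hab
    exact hi' (aux _ _ hab i (show i < k a by omega) hi)
  obtain ⟨β, hβA, hβδ, hβ⟩ := hβ
  obtain ⟨k, ξ, hξ, hk⟩ := hF2 δ hδ1 β hβδ
  obtain ⟨y, hyA, hyδ, hyβ, hyk⟩ := hβ k
  have hne : r y ≠ r β := fun h => hyβ (hr h)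
  obtain ⟨ξ', hξ', hk'⟩ := hF1 δ hδ1 (PiNat.firstDiff (r y) (r β))
  obtain ⟨α, hαA, hαy, hα1, hα2⟩ := key y hyA hyδ (PiNat.firstDiff (r y) (r β) + 1)
    (max ξ ξ') (max_lt hξ hξ')
  have hj := PiNat.apply_firstDiff_ne hne
  have hdiff : r α (PiNat.firstDiff (r y) (r β)) ≠ r β (PiNat.firstDiff (r y) (r β)) := by
    rw [hαy _ (Nat.lt_succ_self _)]; exact hj
  have hne' : r α ≠ r β := fun h => hdiff (by rw [h])
  have hle : PiNat.firstDiff (r α) (r β) ≤ PiNat.firstDiff (r y) (r β) := by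
    by_contra! h
    exact hdiff (PiNat.apply_eq_of_lt_firstDiff h)
  have hge : k ≤ PiNat.firstDiff (r α) (r β) := by
    by_contra! h
    have h1 := PiNat.apply_firstDiff_ne hne'
    apply h1
    rw [hαy _ (by omega), hyk _ h]
  refine ⟨α, hαA, β, hβA, hα2.trans_le hβδ, ?_⟩
  show f _ = γ
  rw [hk α ((le_max_left _ _).trans_lt hα1) hα2 _ hge,
    hk' α ((le_max_right _ _).trans_lt hα1) hα2 _ hle, hfδ]

end

universe u v

theorem mk_w1 : Cardinal.mk (Set.Iio w1.{u}) = Cardinal.aleph 1 := by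
  rw [Cardinal.mk_Iio_ordinal, w1, Cardinal.card_ord]
  simp

theorem exists_strong :
    ∃ c : Ordinal.{u} → Ordinal.{u} → Ordinal.{v},
      (∀ α β : Ordinal, α < β → β < w1 → c α β < w1) ∧
      ∀ A : Set Ordinal, A ⊆ Set.Iio w1 → ¬A.Countable →
        ∀ γ < w1, ∃ α ∈ A, ∃ β ∈ A, α < β ∧ c α β = γ := by
  have hI : ∀ a : Set.Iio w1.{u}, (Set.Iio a).Countable := by
    intro a
    have h1 : (Set.Iio a.1).Countable := by
      rw [← Cardinal.le_aleph0_iff_set_countable, Cardinal.mk_Iio_ordinal,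
        Cardinal.lift_le_aleph0, ← Order.lt_succ_iff, Cardinal.succ_aleph0]
      exact Cardinal.lt_ord.1 a.2
    exact (h1.preimage Subtype.val_injective).mono fun x hx => hx
  obtain ⟨C, hC⟩ := StrongColoring.main hI mk_w1
  obtain ⟨π⟩ : Nonempty (Set.Iio w1.{u} ≃ Set.Iio w1.{v}) := by
    rw [← Cardinal.lift_mk_eq', mk_w1, mk_w1]
    simp
  classical
  refine ⟨fun α β => if h : α ∈ Set.Iio w1 ∧ β ∈ Set.Iio w1 then (π (C ⟨α, h.1⟩ ⟨β, h.2⟩)).1 else 0,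
    ?_, ?_⟩
  · intro α β h1 h2
    have hh : α ∈ Set.Iio w1 ∧ β ∈ Set.Iio w1 := ⟨h1.trans h2, h2⟩
    simp only [dif_pos hh]
    exact (π (C _ _)).2
  · intro A hA hAc γ hγ
    have hA' : ¬ ((Subtype.val : Set.Iio w1 → Ordinal) ⁻¹' A).Countable := by
      intro h
      apply hAc
      refine (h.image Subtype.val).mono ?_
      intro x hx
      exact ⟨⟨x, hA hx⟩, hx, rfl⟩
    obtain ⟨α, hα, β, hβ, hlt, h⟩ := hC _ hA' (π.symm ⟨γ, hγ⟩)
    refine ⟨α, hα, β, hβ, hlt, ?_⟩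
    have hh : α.1 ∈ Set.Iio w1 ∧ β.1 ∈ Set.Iio w1 := ⟨α.2, β.2⟩
    simp only [dif_pos hh]
    have h' : π (C α β) = ⟨γ, hγ⟩ := by rw [h]; simp
    exact congrArg Subtype.val h'

end StrongColoring

/-- There is a colouring `c` of the pairs of countable ordinals with countable
ordinals such that every uncountable `A ⊆ ω₁` realizes every colour `γ < ω₁`. -/
theorem exists_strong_coloring :
    ∃ c : Ordinal → Ordinal → Ordinal,
      (∀ α β : Ordinal, α < β → β < w1 → c α β < w1) ∧
      ∀ A : Set Ordinal, A ⊆ Set.Iio w1 → ¬A.Countable →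
        ∀ γ < w1, ∃ α ∈ A, ∃ β ∈ A, α < β ∧ c α β = γ := by
  exact StrongColoring.exists_strong
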